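/- Let d ≥ 1. Consider the uniform probability measure on the unit sphere S^{d+1} = {y ∈ ℝ^{d+2} : |y| = 1} (the normalized rotation-invariant surface measure), and let π : ℝ^{d+2} → ℝ^d be the projection onto the first d coordinates. Then the pushforward of this measure under π is the uniform probability measure on the closed unit ball {x ∈ ℝ^d : |x| ≤ 1}, i.e., normalized Lebesgue measure on the ball. -/

import Mathlib

open MeasureTheory

open Metric Module
open scoped RealInnerProductSpace ENNReal

section Sphere

variable {E : Type*} [NormedAddCommGroup E] [InnerProductSpace ℝ E]
  [MeasurableSpace E] [BorelSpace E]

theorem charFun_eq_of_norm_eq {μ : Measure E} (hμ : ∀ A : E ≃ₗᵢ[ℝ] E, μ.map A = μ) {s t : E}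
    (h : ‖s‖ = ‖t‖) : charFun μ s = charFun μ t := by
  set A : E ≃ₗᵢ[ℝ] E := (ℝ ∙ (s - t))ᗮ.reflection with hA
  have hst : A s = t := Submodule.reflection_sub h
  calc charFun μ s = ∫ x, Complex.exp (⟪A x, A s⟫ * Complex.I) ∂μ := by
        simp [charFun_apply]
    _ = charFun (μ.map A) t := by
        rw [charFun_apply, hst]
        exact (A.toHomeomorph.toMeasurableEquiv.measurableEmbedding.integral_map
          (fun x => Complex.exp (⟪x, t⟫ * Complex.I))).symm
    _ = charFun μ t := by rw [hμ]

theorem map_hausdorffMeasure_restrict_sphere (r : ℝ) (A : E ≃ₗᵢ[ℝ] E) :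
    (μH[r].restrict (sphere (0 : E) 1)).map A = μH[r].restrict (sphere (0 : E) 1) := by
  have h := Measure.restrict_map (μ := μH[r]) A.continuous.measurable
    (isClosed_sphere (x := (0 : E)) (ε := 1)).measurableSet
  rw [show A ⁻¹' sphere (0 : E) 1 = sphere 0 1 by ext; simp] at h
  rw [← h]
  congr 1
  exact A.toIsometryEquiv.map_hausdorffMeasure r

variable [FiniteDimensional ℝ E]

/-- Two finite rotation-invariant measures carried by the unit sphere are proportional. -/
theorem measure_univ_smul_eq_of_isometry_invariant {μ ν : Measure E} [IsFiniteMeasure μ]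
    [IsFiniteMeasure ν] (hμ : ∀ A : E ≃ₗᵢ[ℝ] E, μ.map A = μ) (hν : ∀ A : E ≃ₗᵢ[ℝ] E, ν.map A = ν)
    (hμs : ∀ᵐ x ∂μ, ‖x‖ = 1) (hνs : ∀ᵐ x ∂ν, ‖x‖ = 1) :
    μ Set.univ • ν = ν Set.univ • μ := by
  have key : ∀ t : E, μ.real Set.univ • charFun ν t = ν.real Set.univ • charFun μ t := by
    intro t
    have hsph : ∀ (ρ κ : Measure E) [IsFiniteMeasure κ],
        (∀ A : E ≃ₗᵢ[ℝ] E, ρ.map A = ρ) → (∀ᵐ x ∂κ, ‖x‖ = 1) →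
        ∫ x, charFun ρ (‖t‖ • x) ∂κ = κ.real Set.univ • charFun ρ t := by
      intro ρ κ _ hρ hκ
      rw [← integral_const]
      refine integral_congr_ae ?_
      filter_upwards [hκ] with x hx
      exact charFun_eq_of_norm_eq hρ (by simp [norm_smul, hx])
    rw [← hsph ν μ hν hμs, ← hsph μ ν hμ hνs]
    simp_rw [charFun_apply]
    rw [integral_integral_swap]
    · refine integral_congr_ae (.of_forall fun y => integral_congr_ae (.of_forall fun x => ?_))
      simp only [real_inner_smul_right, real_inner_comm]
    · refine Integrable.of_bound (C := 1) ?_ (.of_forall fun p => ?_)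
      · exact Continuous.aestronglyMeasurable (by unfold Function.uncurry; fun_prop)
      · simp only [Function.uncurry, Complex.norm_exp_ofReal_mul_I, le_refl]
  have h1 : IsFiniteMeasure (μ Set.univ • ν) := ν.smul_finite (measure_ne_top _ _)
  have h2 : IsFiniteMeasure (ν Set.univ • μ) := μ.smul_finite (measure_ne_top _ _)
  refine Measure.ext_of_charFun (funext fun t => ?_)
  simpa [charFun_apply, integral_smul_measure, Measure.real] using key t

theorem hausdorffMeasure_sphere_inter_lt_top {n : ℕ} (hn : finrank ℝ E = n + 1) {v : E}
    (hv : ‖v‖ = 1) : μH[(n : ℝ)] {x ∈ sphere (0 : E) 1 | ⟪v, x⟫ ≤ 0} < ∞ := by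
  have hfr : finrank ℝ (ℝ ∙ v)ᗮ = n := by
    have : Fact (finrank ℝ E = n + 1) := ⟨hn⟩
    exact Submodule.finrank_orthogonal_span_singleton (by rintro rfl; simp at hv)
  let f : (ℝ ∙ v)ᗮ → E := fun w => stereoInvFunAux v w
  have hf : LocallyLipschitz f :=
    ((contDiff_stereoInvFunAux (m := 1)).comp (ℝ ∙ v)ᗮ.subtypeL.contDiff).locallyLipschitz
  have hc : IsCompact (closedBall (0 : (ℝ ∙ v)ᗮ) 2) := isCompact_closedBall 0 2
  obtain ⟨K, hK⟩ :=
    (hf.locallyLipschitzOn (s := closedBall 0 2)).exists_lipschitzOnWith_of_compact hc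
  have hsub : {x ∈ sphere (0 : E) 1 | ⟪v, x⟫ ≤ 0} ⊆ f '' closedBall 0 2 := by
    rintro x ⟨hx, hvx⟩
    refine ⟨stereoToFun v x, ?_, ?_⟩
    · have hx1 : ‖x‖ = 1 := by simpa using hx
      have h1 : ‖(ℝ ∙ v)ᗮ.orthogonalProjectionOnto x‖ ≤ 1 :=
        hx1 ▸ Submodule.norm_orthogonalProjectionOnto_apply_le _ x
      have h2 : |2 / (1 - ⟪v, x⟫)| ≤ 2 := by
        rw [abs_of_nonneg (by apply div_nonneg <;> linarith), div_le_iff₀ (by linarith)]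
        linarith
      simp only [mem_closedBall_zero_iff, stereoToFun_apply, innerSL_apply_apply, norm_smul,
        Real.norm_eq_abs]
      nlinarith [norm_nonneg ((ℝ ∙ v)ᗮ.orthogonalProjectionOnto x)]
    · have hxv : x ≠ v := by
        rintro rfl
        rw [real_inner_self_eq_norm_sq, hv] at hvx
        norm_num at hvx
      exact congrArg Subtype.val (stereo_left_inv hv (x := ⟨x, hx⟩) hxv)
  calc _ ≤ μH[(n : ℝ)] (f '' closedBall 0 2) := measure_mono hsub
    _ ≤ (K : ℝ≥0∞) ^ (n : ℝ) * μH[(n : ℝ)] (closedBall (0 : (ℝ ∙ v)ᗮ) 2) :=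
      hK.hausdorffMeasure_image_le (by positivity)
    _ < ∞ := by
      refine ENNReal.mul_lt_top (ENNReal.rpow_lt_top_of_nonneg (by positivity) (by simp)) ?_
      rw [← hfr]
      exact hc.measure_lt_top

theorem hausdorffMeasure_sphere_lt_top {n : ℕ} (hn : finrank ℝ E = n + 1) :
    μH[(n : ℝ)] (sphere (0 : E) 1) < ∞ := by
  have : Nontrivial E := nontrivial_of_finrank_pos (R := ℝ) (by omega)
  obtain ⟨v, hv⟩ := exists_norm_eq E (zero_le_one' ℝ)
  have hsub : sphere (0 : E) 1 ⊆
      {x ∈ sphere (0 : E) 1 | ⟪v, x⟫ ≤ 0} ∪ {x ∈ sphere (0 : E) 1 | ⟪-v, x⟫ ≤ 0} := by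
    intro x hx
    rcases le_total ⟪v, x⟫ 0 with h | h
    · exact Or.inl ⟨hx, h⟩
    · exact Or.inr ⟨hx, by simpa using h⟩
  exact (measure_mono hsub).trans_lt <| (measure_union_le _ _).trans_lt <| ENNReal.add_lt_top.2
    ⟨hausdorffMeasure_sphere_inter_lt_top hn hv,
      hausdorffMeasure_sphere_inter_lt_top hn (by simpa using hv)⟩

theorem hausdorffMeasure_sphere_pos {n : ℕ} (hn : finrank ℝ E = n + 1) :
    0 < μH[(n : ℝ)] (sphere (0 : E) 1) := by
  have : Nontrivial E := nontrivial_of_finrank_pos (R := ℝ) (by omega)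
  obtain ⟨v, hv⟩ := exists_norm_eq E (zero_le_one' ℝ)
  have hfr : finrank ℝ (ℝ ∙ v)ᗮ = n := by
    have : Fact (finrank ℝ E = n + 1) := ⟨hn⟩
    exact Submodule.finrank_orthogonal_span_singleton (by rintro rfl; simp at hv)
  have hsub : ball (0 : (ℝ ∙ v)ᗮ) 1 ⊆
      (ℝ ∙ v)ᗮ.orthogonalProjectionOnto '' sphere (0 : E) 1 := by
    intro w hw
    have hw1 : ‖w‖ < 1 := by simpa using hw
    have hwv : ⟪(w : E), v⟫ = 0 := Submodule.mem_orthogonal_singleton_iff_inner_left.1 w.2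
    refine ⟨w + √(1 - ‖w‖ ^ 2) • v, ?_, ?_⟩
    · have : ‖(w : E) + √(1 - ‖w‖ ^ 2) • v‖ ^ 2 = 1 := by
        rw [norm_add_sq_real, inner_smul_right, hwv, norm_smul, hv, Real.norm_eq_abs, mul_one,
          sq_abs, Real.sq_sqrt (by nlinarith [norm_nonneg w])]
        simp
      rw [mem_sphere_zero_iff_norm]
      nlinarith [norm_nonneg ((w : E) + √(1 - ‖w‖ ^ 2) • v)]
    · simp [Submodule.orthogonalProjectionOnto_orthogonalComplement_singleton_eq_zero]
  have hpos : 0 < μH[(n : ℝ)] (ball (0 : (ℝ ∙ v)ᗮ) 1) := by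
    rw [← hfr]
    exact measure_ball_pos _ _ one_pos
  calc 0 < _ := hpos
    _ ≤ _ := measure_mono hsub
    _ ≤ _ := hausdorffMeasure_orthogonalProjectionOnto_le _ _ _ (by positivity)

theorem map_inv_norm_smul_isometry_invariant (A : E ≃ₗᵢ[ℝ] E) :
    ((volume.restrict (ball (0 : E) 1)).map fun x => ‖x‖⁻¹ • x).map A =
      (volume.restrict (ball (0 : E) 1)).map fun x => ‖x‖⁻¹ • x := by
  have hA : (volume.restrict (ball (0 : E) 1)).map A = volume.restrict (ball (0 : E) 1) := by
    have h := Measure.restrict_map (μ := (volume : Measure E)) A.continuous.measurable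
      (measurableSet_ball (x := (0 : E)) (ε := 1))
    rw [show A ⁻¹' ball (0 : E) 1 = ball 0 1 by ext; simp] at h
    rw [← h, A.measurePreserving.map_eq]
  have hmA : Measurable A := A.continuous.measurable
  conv_rhs => rw [← hA]
  rw [Measure.map_map hmA (by fun_prop), Measure.map_map (by fun_prop) hmA]
  congr 1
  ext x
  simp

theorem ae_norm_map_inv_norm_smul [Nontrivial E] :
    ∀ᵐ x ∂((volume.restrict (ball (0 : E) 1)).map fun x => ‖x‖⁻¹ • x), ‖x‖ = 1 := by
  rw [ae_map_iff (by fun_prop) (measurableSet_eq_fun (by fun_prop) (by fun_prop))]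
  refine ae_restrict_of_ae ?_
  filter_upwards [Measure.ae_ne volume (0 : E)] with x hx
  rw [norm_smul, norm_inv, norm_norm, inv_mul_cancel₀ (norm_ne_zero_iff.2 hx)]

/-- Every rotation-invariant finite measure on the unit sphere is proportional to the radial
projection of Lebesgue measure on the unit ball. -/
theorem exists_eq_smul_map_inv_norm_smul [Nontrivial E] {μ : Measure E} [IsFiniteMeasure μ]
    (hμ : ∀ A : E ≃ₗᵢ[ℝ] E, μ.map A = μ) (hμs : ∀ᵐ x ∂μ, ‖x‖ = 1) :
    ∃ c : ℝ≥0∞, μ = c • (volume.restrict (ball (0 : E) 1)).map fun x => ‖x‖⁻¹ • x := by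
  set ν := (volume.restrict (ball (0 : E) 1)).map fun x => ‖x‖⁻¹ • x with hν
  have : IsFiniteMeasure (volume.restrict (ball (0 : E) 1)) :=
    isFiniteMeasure_restrict.2 measure_ball_lt_top.ne
  have hν0 : ν Set.univ ≠ 0 := by
    rw [hν, Measure.map_apply (by fun_prop) .univ, Set.preimage_univ, Measure.restrict_apply_univ]
    exact (measure_ball_pos _ _ one_pos).ne'
  have h := measure_univ_smul_eq_of_isometry_invariant hμ map_inv_norm_smul_isometry_invariant hμs
    ae_norm_map_inv_norm_smul
  refine ⟨(ν Set.univ)⁻¹ * μ Set.univ, ?_⟩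
  rw [mul_smul, h, smul_smul, ENNReal.inv_mul_cancel hν0 (measure_ne_top _ _), one_smul]

end Sphere

theorem Complex.lintegral_comp_add_norm_sq (a : ℝ) {h : ℝ → ℝ≥0∞} (hh : Measurable h) :
    ∫⁻ z : ℂ, h (a + ‖z‖ ^ 2) = ENNReal.ofReal Real.pi * ∫⁻ u in Set.Ioi a, h u := by
  have himg : (fun r : ℝ => a + r ^ 2) '' Set.Ioi 0 = Set.Ioi a := by
    ext u
    constructor
    · rintro ⟨r, hr, rfl⟩
      exact lt_add_of_pos_right a (pow_pos hr 2)
    · intro hu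
      have hu' : 0 < u - a := sub_pos.2 hu
      exact ⟨√(u - a), Real.sqrt_pos.2 hu', by simp [Real.sq_sqrt hu'.le]⟩
  have hinj : Set.InjOn (fun r : ℝ => a + r ^ 2) (Set.Ioi 0) := by
    intro r hr s hs hrs
    exact (pow_left_inj₀ (le_of_lt hr) (le_of_lt hs) two_ne_zero).1 (add_left_cancel hrs)
  have hcov := lintegral_image_eq_lintegral_abs_deriv_mul (f' := fun r => 2 * r)
    measurableSet_Ioi (fun r _ => by
      simpa using ((hasDerivAt_pow 2 r).const_add a).hasDerivWithinAt) hinj h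
  rw [himg] at hcov
  rw [hcov, ← Complex.lintegral_comp_polarCoord_symm]
  simp_rw [Complex.norm_polarCoord_symm, sq_abs, smul_eq_mul]
  rw [polarCoord_target, Measure.volume_eq_prod, ← Measure.prod_restrict,
    lintegral_prod _ (by fun_prop), ← lintegral_const_mul _ (by fun_prop)]
  refine setLIntegral_congr_fun measurableSet_Ioi fun r hr => ?_
  have hr0 : (0 : ℝ) < r := hr
  simp only [lintegral_const, Measure.restrict_apply_univ, Real.volume_Ioo]
  rw [abs_of_pos (by positivity), ← mul_assoc, ← ENNReal.ofReal_mul Real.pi_pos.le, mul_right_comm,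
    ← ENNReal.ofReal_mul hr0.le]
  congr 2
  ring

section

variable {F : Type*} [NormedAddCommGroup F] [NormedSpace ℝ F] [FiniteDimensional ℝ F]
  [MeasurableSpace F] [BorelSpace F] (μ : Measure F) [μ.IsAddHaarMeasure]

theorem setLIntegral_ball_comp_inv_smul {r : ℝ} (hr : 0 < r) (g : F → ℝ≥0∞) :
    ∫⁻ x in ball 0 r, g (r⁻¹ • x) ∂μ =
      ENNReal.ofReal (r ^ finrank ℝ F) * ∫⁻ x in ball 0 1, g x ∂μ := by
  let e : F ≃ᵐ F := (Homeomorph.smulOfNeZero r⁻¹ (inv_ne_zero hr.ne')).toMeasurableEquiv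
  have hpre : (r⁻¹ • ·) ⁻¹' ball (0 : F) 1 = ball 0 r := by
    ext x
    simp [norm_smul, abs_of_pos hr, inv_mul_lt_iff₀ hr]
  have h := e.measurableEmbedding.lintegral_map (μ := μ.restrict (e ⁻¹' ball 0 1)) g
  have he : ⇑e = (r⁻¹ • ·) := rfl
  rw [← e.restrict_map, he, Measure.map_addHaar_smul μ (inv_ne_zero hr.ne'), Measure.restrict_smul,
    lintegral_smul_measure, hpre] at h
  rw [← h, smul_eq_mul, inv_pow, inv_inv, abs_of_pos (by positivity)]

theorem exists_lintegral_inv_sqrt_smul_eq :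
    ∃ c : ℝ≥0∞, ∀ g : F → ℝ≥0∞, Measurable g →
      ∫⁻ p : F × ℂ in {p | ‖p.1‖ ^ 2 + ‖p.2‖ ^ 2 < 1},
        g ((√(‖p.1‖ ^ 2 + ‖p.2‖ ^ 2))⁻¹ • p.1) ∂(μ.prod volume) =
      c * ∫⁻ x in ball 0 1, g x ∂μ := by
  refine ⟨ENNReal.ofReal Real.pi *
    ∫⁻ u in Set.Ioo (0 : ℝ) 1, ENNReal.ofReal (√u ^ finrank ℝ F), fun g hg => ?_⟩
  let k : F → ℝ → ℝ≥0∞ := fun x u => (Set.Iio (1 : ℝ)).indicator (fun u => g ((√u)⁻¹ • x)) u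
  have hk : Measurable (Function.uncurry k) := by
    have : Function.uncurry k =
        {p : F × ℝ | p.2 < 1}.indicator fun p => g ((√p.2)⁻¹ • p.1) := by
      ext p
      simp [k, Function.uncurry, Set.indicator_apply]
    rw [this]
    exact Measurable.indicator (by fun_prop) (measurableSet_lt (by fun_prop) (by fun_prop))
  have hkx : ∀ x, Measurable (k x) := fun x => hk.comp measurable_prodMk_left
  calc _ = ∫⁻ p : F × ℂ, k p.1 (‖p.1‖ ^ 2 + ‖p.2‖ ^ 2) ∂(μ.prod volume) := by
        rw [← lintegral_indicator (measurableSet_lt (by fun_prop) (by fun_prop))]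
        refine lintegral_congr fun p => ?_
        simp [k, Set.indicator_apply]
    _ = ∫⁻ x, (ENNReal.ofReal Real.pi * ∫⁻ u in Set.Ioi (‖x‖ ^ 2), k x u) ∂μ := by
        rw [lintegral_prod _ (by
          exact (hk.comp (f := fun p : F × ℂ => (p.1, ‖p.1‖ ^ 2 + ‖p.2‖ ^ 2))
            (by fun_prop)).aemeasurable)]
        exact lintegral_congr fun x => Complex.lintegral_comp_add_norm_sq (‖x‖ ^ 2) (hkx x)
    _ = ENNReal.ofReal Real.pi *
        ∫⁻ x, (∫⁻ u, {p : F × ℝ | ‖p.1‖ ^ 2 < p.2}.indicator (Function.uncurry k) (x, u)) ∂μ := by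
        rw [lintegral_const_mul' _ _ ENNReal.ofReal_ne_top]
        congr 1
        refine lintegral_congr fun x => ?_
        rw [← lintegral_indicator measurableSet_Ioi]
        refine lintegral_congr fun u => ?_
        simp [Set.indicator_apply, Function.uncurry]
    _ = ENNReal.ofReal Real.pi *
        ∫⁻ u, ∫⁻ x, {p : F × ℝ | ‖p.1‖ ^ 2 < p.2}.indicator (Function.uncurry k) (x, u) ∂μ := by
        rw [lintegral_lintegral_swap]
        exact (hk.indicator (measurableSet_lt (by fun_prop) (by fun_prop))).aemeasurable
    _ = ENNReal.ofReal Real.pi * ∫⁻ u in Set.Ioo (0 : ℝ) 1,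
        ENNReal.ofReal (√u ^ finrank ℝ F) * ∫⁻ x in ball 0 1, g x ∂μ := by
        congr 1
        rw [← lintegral_indicator measurableSet_Ioo]
        refine lintegral_congr fun u => ?_
        by_cases hu : u ∈ Set.Ioo (0 : ℝ) 1
        · rw [Set.indicator_of_mem hu,
            ← setLIntegral_ball_comp_inv_smul μ (Real.sqrt_pos.2 hu.1) g,
            ← lintegral_indicator measurableSet_ball]
          refine lintegral_congr fun x => ?_
          classical
          simp only [Set.indicator_apply, Function.uncurry, k, Set.mem_ofPred_eq, Set.mem_Iio, hu.2,
            mem_ball_zero_iff, Real.lt_sqrt (norm_nonneg x), if_true]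
        · rw [Set.indicator_of_notMem hu]
          refine (lintegral_congr fun x => ?_).trans lintegral_zero
          rw [Set.indicator_apply_eq_zero]
          intro (hx : ‖x‖ ^ 2 < u)
          have hu1 : u ∉ Set.Iio 1 := fun hu1 => hu ⟨lt_of_le_of_lt (by positivity) hx, hu1⟩
          exact Set.indicator_of_notMem hu1 fun u => g ((√u)⁻¹ • x)
    _ = _ := by
        rw [lintegral_mul_const _ (by fun_prop), mul_assoc]

end

/-- Splitting off the last two coordinates of `ℝ^(d+2)` as a complex number. -/
noncomputable def EuclideanSpace.equivProdComplex (d : ℕ) :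
    EuclideanSpace ℝ (Fin (d + 2)) ≃L[ℝ] EuclideanSpace ℝ (Fin d) × ℂ :=
  EuclideanSpace.finAddEquivProd.trans <| (ContinuousLinearEquiv.refl ℝ _).prodCongr
    Complex.orthonormalBasisOneI.repr.symm.toContinuousLinearEquiv

theorem EuclideanSpace.equivProdComplex_fst (d : ℕ) (y : EuclideanSpace ℝ (Fin (d + 2))) :
    (equivProdComplex d y).1 =
      (EuclideanSpace.equiv (Fin d) ℝ).symm fun i => y (Fin.castAdd 2 i) := by
  ext i
  simp [equivProdComplex]

theorem EuclideanSpace.norm_sq_equivProdComplex (d : ℕ) (y : EuclideanSpace ℝ (Fin (d + 2))) :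
    ‖(equivProdComplex d y).1‖ ^ 2 + ‖(equivProdComplex d y).2‖ ^ 2 = ‖y‖ ^ 2 := by
  have h : ‖(equivProdComplex d y).2‖ = ‖(EuclideanSpace.finAddEquivProd (𝕜 := ℝ) y).2‖ :=
    Complex.orthonormalBasisOneI.repr.symm.norm_map _
  rw [h, equivProdComplex_fst]
  simp only [EuclideanSpace.real_norm_sq_eq, Fin.sum_univ_add]
  rfl

theorem EuclideanSpace.exists_map_drop_inv_norm_smul_eq (d : ℕ) :
    ∃ c : ℝ≥0∞, ((volume.restrict (ball (0 : EuclideanSpace ℝ (Fin (d + 2))) 1)).map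
        fun y => ‖y‖⁻¹ • y).map (fun y =>
          (EuclideanSpace.equiv (Fin d) ℝ).symm (fun i : Fin d => y (Fin.castAdd 2 i))) =
      c • volume.restrict (ball (0 : EuclideanSpace ℝ (Fin d)) 1) := by
  set L := equivProdComplex d
  have hLm : MeasurableEmbedding L := L.toHomeomorph.measurableEmbedding
  have : (volume.map L).IsAddHaarMeasure := L.isAddHaarMeasure_map volume
  obtain ⟨κ, hκ⟩ : ∃ κ : ℝ≥0∞, volume.map L =
      κ • (volume : Measure (EuclideanSpace ℝ (Fin d))).prod (volume : Measure ℂ) :=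
    ⟨_, Measure.isAddLeftInvariant_eq_smul _ _⟩
  obtain ⟨c, hc⟩ := exists_lintegral_inv_sqrt_smul_eq (volume : Measure (EuclideanSpace ℝ (Fin d)))
  refine ⟨κ * c, Measure.ext_of_lintegral _ fun g hg => ?_⟩
  simp_rw [← equivProdComplex_fst]
  have hLc : Measurable (fun y => (L y).1) := (continuous_fst.comp L.continuous).measurable
  have hpre : L ⁻¹' {p | ‖p.1‖ ^ 2 + ‖p.2‖ ^ 2 < 1} = ball 0 1 := by
    ext y
    simp [L, norm_sq_equivProdComplex]
  rw [lintegral_map hg hLc, lintegral_map (f := fun y => g (L y).1) (hg.comp hLc) (by fun_prop),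
    lintegral_smul_measure, smul_eq_mul, mul_assoc, ← hc g hg, ← smul_eq_mul, ← lintegral_smul_measure,
    ← Measure.restrict_smul, ← hκ, hLm.restrict_map, hLm.lintegral_map, hpre]
  refine lintegral_congr fun y => ?_
  rw [norm_sq_equivProdComplex, Real.sqrt_sq (norm_nonneg y), map_smul, Prod.smul_fst]

/-- Dropped-coordinates sampling: the pushforward of the uniform probability measure on
the unit sphere `S^{d+1} ⊆ ℝ^{d+2}` (normalized `(d+1)`-dimensional Hausdorff measure on
the sphere) under the projection onto the first `d` coordinates is the uniform
probability measure (normalized Lebesgue measure) on the closed unit ball in `ℝ^d`. -/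
theorem dropped_coordinates_uniform (d : ℕ) (hd : 1 ≤ d) :
    Measure.map
      (fun y : EuclideanSpace ℝ (Fin (d + 2)) =>
        (EuclideanSpace.equiv (Fin d) ℝ).symm (fun i : Fin d => y (Fin.castAdd 2 i)))
      ((μH[(d + 1 : ℝ)] (Metric.sphere (0 : EuclideanSpace ℝ (Fin (d + 2))) 1))⁻¹ •
        μH[(d + 1 : ℝ)].restrict (Metric.sphere (0 : EuclideanSpace ℝ (Fin (d + 2))) 1))
      = (volume (Metric.closedBall (0 : EuclideanSpace ℝ (Fin d)) 1))⁻¹ •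
        volume.restrict (Metric.closedBall (0 : EuclideanSpace ℝ (Fin d)) 1) := by
  have hfr : finrank ℝ (EuclideanSpace ℝ (Fin (d + 2))) = (d + 1) + 1 := by simp
  have hfin := hausdorffMeasure_sphere_lt_top hfr
  have hpos := hausdorffMeasure_sphere_pos hfr
  rw [Nat.cast_add, Nat.cast_one] at hfin hpos
  set S := sphere (0 : EuclideanSpace ℝ (Fin (d + 2))) 1
  have : IsFiniteMeasure (μH[(d + 1 : ℝ)].restrict S) := isFiniteMeasure_restrict.2 hfin.ne
  obtain ⟨a, ha⟩ := exists_eq_smul_map_inv_norm_smul (μ := μH[(d + 1 : ℝ)].restrict S)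
    (map_hausdorffMeasure_restrict_sphere _) <| by
      filter_upwards [ae_restrict_mem isClosed_sphere.measurableSet] with x hx
      simpa [S] using hx
  obtain ⟨b, hb⟩ := EuclideanSpace.exists_map_drop_inv_norm_smul_eq d
  have hball : volume.restrict (ball (0 : EuclideanSpace ℝ (Fin d)) 1) =
      volume.restrict (closedBall (0 : EuclideanSpace ℝ (Fin d)) 1) :=
    Measure.restrict_congr_set
      (ae_eq_of_subset_of_measure_ge ball_subset_closedBall
        (Measure.addHaar_unitClosedBall_eq_addHaar_unitBall volume).le
        measurableSet_ball.nullMeasurableSet measure_closedBall_lt_top.ne)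
  set π : EuclideanSpace ℝ (Fin (d + 2)) → EuclideanSpace ℝ (Fin d) := fun y =>
    (EuclideanSpace.equiv (Fin d) ℝ).symm (fun i : Fin d => y (Fin.castAdd 2 i))
  have hπ : Measurable π := by
    refine (Continuous.measurable ?_)
    exact (EuclideanSpace.equiv (Fin d) ℝ).symm.continuous.comp (by fun_prop)
  have hmap : ((μH[(d + 1 : ℝ)] S)⁻¹ • μH[(d + 1 : ℝ)].restrict S).map π =
      ((μH[(d + 1 : ℝ)] S)⁻¹ * a * b) •
        volume.restrict (closedBall (0 : EuclideanSpace ℝ (Fin d)) 1) := by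
    rw [ha, Measure.map_smul, Measure.map_smul, hb, hball, smul_smul, smul_smul, mul_assoc]
  have hmass := congrArg (fun μ => μ Set.univ) hmap
  simp only [Measure.map_apply hπ .univ, Set.preimage_univ, Measure.smul_apply, smul_eq_mul,
    Measure.restrict_apply_univ, ENNReal.inv_mul_cancel hpos.ne' hfin.ne] at hmass
  rw [hmap, ENNReal.eq_inv_of_mul_eq_one_left hmass.symm]
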